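/- arXiv:2102.04547 — 5 statements merged into one kernel-verified Lean document; each statement's English description precedes it below -/
import Mathlib

section
/- There exists γ₀ ∈ (0,1) such that for every stepsize γ ∈ (0, γ₀) the sequence of true states {x(t)} generated by the asynchronous block coordinate descent algorithm satisfies, for some finite constant η > 0 and all k = 0, 1, 2, …: f(x(kB)) − f* ≤ (1 − γμ)^{k−1} η and γ² Σ_{τ=(k−1)B}^{kB−1} ‖s(τ)‖² ≤ (1 − γμ)^{k−1} η. In particular f(x(t)) converges to f* at a linear rate. -/
open scoped BigOperators
open Classical

/-- A descent inequality for a function with Lipschitz gradient, from the mean value theorem. -/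
theorem descent_of_lipschitz_gradient {E : Type*} [NormedAddCommGroup E] [InnerProductSpace ℝ E]
    [CompleteSpace E] {f : E → ℝ} {L : ℝ} (hL : 0 ≤ L) (hdiff : Differentiable ℝ f)
    (hLip : ∀ y z, ‖gradient f z - gradient f y‖ ≤ L * ‖z - y‖) (y d : E) :
    f (y + d) - f y ≤ inner ℝ (gradient f y) d + L * ‖d‖ ^ 2 := by
  have hder : ∀ r : ℝ, HasDerivAt (fun r : ℝ => f (y + r • d))
      (inner ℝ (gradient f (y + r • d)) d) r := by
    intro r
    have h1 : HasDerivAt (fun r : ℝ => y + r • d) d r := by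
      simpa using ((hasDerivAt_id r).smul_const d).const_add y
    have h2 := (hdiff (y + r • d)).hasGradientAt.hasFDerivAt.comp_hasDerivAt r h1
    exact h2.congr_deriv (by simp)
  obtain ⟨r, ⟨hr0, hr1⟩, hr⟩ := exists_hasDerivAt_eq_slope (fun r : ℝ => f (y + r • d)) _
    zero_lt_one (fun r _ => (hder r).continuousAt.continuousWithinAt) (fun r _ => hder r)
  have hslope : f (y + d) - f y = inner ℝ (gradient f (y + r • d)) d := by
    rw [hr]; simp
  have hdist : ‖gradient f (y + r • d) - gradient f y‖ ≤ L * ‖d‖ := by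
    refine (hLip _ _).trans (mul_le_mul_of_nonneg_left ?_ hL)
    rw [add_sub_cancel_left, norm_smul, Real.norm_eq_abs, abs_of_pos hr0]
    exact mul_le_of_le_one_left (norm_nonneg d) hr1.le
  have hinner : inner ℝ (gradient f (y + r • d) - gradient f y) d ≤ L * ‖d‖ * ‖d‖ :=
    (real_inner_le_norm _ _).trans (mul_le_mul_of_nonneg_right hdist (norm_nonneg d))
  rw [inner_sub_left] at hinner
  linarith

/-- Squared displacement of a scalar sequence between two times of a window. -/
theorem sq_sub_le_window_sum {u v : ℕ → ℝ} {γ : ℝ} (hstep : ∀ t, u (t + 1) = u t + γ * v t)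
    {p q a b : ℕ} (ha : p ≤ a) (haq : a ≤ q) (hb : p ≤ b) (hbq : b ≤ q) :
    (u a - u b) ^ 2 ≤ γ ^ 2 * ((q - p : ℕ) * ∑ t ∈ Finset.Ico p q, v t ^ 2) := by
  wlog hab : b ≤ a generalizing a b
  · rw [sub_sq_comm]
    exact this hb hbq ha haq (le_of_not_ge hab)
  have htel : u a - u b = γ * ∑ t ∈ Finset.Ico b a, v t := by
    rw [← Finset.sum_Ico_sub u hab, Finset.mul_sum]
    exact Finset.sum_congr rfl fun t _ => by rw [hstep]; ring
  have hcs := sq_sum_le_card_mul_sum_sq (s := Finset.Ico b a) (f := v)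
  rw [Nat.card_Ico] at hcs
  have hsub : ∑ t ∈ Finset.Ico b a, v t ^ 2 ≤ ∑ t ∈ Finset.Ico p q, v t ^ 2 :=
    Finset.sum_le_sum_of_subset_of_nonneg (Finset.Ico_subset_Ico hb haq) fun _ _ _ => sq_nonneg _
  have hcard : ((a - b : ℕ) : ℝ) ≤ ((q - p : ℕ) : ℝ) := by
    exact_mod_cast (by omega : a - b ≤ q - p)
  rw [htel, mul_pow]
  refine mul_le_mul_of_nonneg_left (hcs.trans ?_) (sq_nonneg γ)
  exact mul_le_mul hcard hsub (Finset.sum_nonneg fun _ _ => sq_nonneg _) (Nat.cast_nonneg _)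

/-- Distance between a state and a vector assembled from coordinates of states in a window. -/
theorem norm_sub_sq_le_window_sum {m : ℕ} {x s : ℕ → EuclideanSpace ℝ (Fin m)} {γ : ℝ}
    (hstep : ∀ t c, x (t + 1) c = x t c + γ * s t c) {p q a : ℕ} (ha : p ≤ a) (haq : a ≤ q)
    {y : EuclideanSpace ℝ (Fin m)} (hy : ∀ c, ∃ b, p ≤ b ∧ b ≤ q ∧ y c = x b c) :
    ‖x a - y‖ ^ 2 ≤ γ ^ 2 * ((q - p : ℕ) * ∑ t ∈ Finset.Ico p q, ‖s t‖ ^ 2) := by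
  simp only [EuclideanSpace.real_norm_sq_eq]
  rw [Finset.sum_comm, Finset.mul_sum, Finset.mul_sum]
  refine Finset.sum_le_sum fun c _ => ?_
  obtain ⟨b, hb, hbq, hyb⟩ := hy c
  rw [PiLp.sub_apply, hyb]
  exact sq_sub_le_window_sum (u := fun t => x t c) (fun t => hstep t c) ha haq hb hbq

/-- Decrease of `f` along one inexact gradient step whose active coordinates have gradient
error at most `E` in square. -/
theorem inexact_gradient_step {m : ℕ} {f : EuclideanSpace ℝ (Fin m) → ℝ} {L γ E : ℝ}
    (hL : 0 ≤ L) (hE : 0 ≤ E) (hdiff : Differentiable ℝ f)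
    (hLip : ∀ y z, ‖gradient f z - gradient f y‖ ≤ L * ‖z - y‖)
    {y d : EuclideanSpace ℝ (Fin m)}
    (herr : ∀ c, d c = 0 ∨ (gradient f y c + d c) ^ 2 ≤ E) :
    f (y + γ • d) - f y ≤ -γ * ‖d‖ ^ 2 + γ ^ 2 * (1 / 2 + L) * ‖d‖ ^ 2 + m * (E / 2) := by
  have hcoord : ∀ c, γ * (gradient f y c * d c) ≤ (-γ + γ ^ 2 / 2) * d c ^ 2 + E / 2 := by
    intro c
    rcases herr c with h | h
    · simp [h]; positivity
    · nlinarith [sq_nonneg (γ * d c - (gradient f y c + d c))]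
  have hinner : γ * inner ℝ (gradient f y) d ≤ (-γ + γ ^ 2 / 2) * ‖d‖ ^ 2 + m * (E / 2) := by
    have h := Finset.sum_le_sum fun c (_ : c ∈ Finset.univ) => hcoord c
    rw [Finset.sum_add_distrib, ← Finset.mul_sum, ← Finset.mul_sum] at h
    rw [PiLp.inner_apply, EuclideanSpace.real_norm_sq_eq]
    simpa [mul_comm] using h
  have h := descent_of_lipschitz_gradient hL hdiff hLip y (γ • d)
  rw [inner_smul_right, norm_smul, Real.norm_eq_abs, mul_pow, sq_abs] at h
  linarith

/-- One step of the Lyapunov recursion for `F + γ S / 4`. -/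
theorem lyapunov_step {F F' S S' C γ μ : ℝ} (hS : 0 ≤ S) (hS' : 0 ≤ S') (hγ : 0 < γ)
    (hC : C * γ ≤ 1 / 12) (hμ : γ * μ ≤ 1 / 2)
    (hdesc : F' ≤ F - γ * S' + C * γ ^ 2 * (S + S'))
    (hPL : 2 * μ * F ≤ S' + C * γ * (S + S')) :
    F' + γ / 4 * S' ≤ (1 - γ * μ) * (F + γ / 4 * S) := by
  have h1 := mul_le_mul_of_nonneg_left hPL (by positivity : 0 ≤ γ / 2)
  have h2 := mul_le_mul_of_nonneg_right hC (by positivity : 0 ≤ γ * (S + S'))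
  have h3 := mul_le_mul_of_nonneg_right hμ (by positivity : 0 ≤ γ * S)
  have h4 : 0 ≤ γ * S' := by positivity
  nlinarith

section Window

variable {m B : ℕ} {f : EuclideanSpace ℝ (Fin m) → ℝ} {L γ : ℝ}
  {x s : ℕ → EuclideanSpace ℝ (Fin m)} {A : Fin m → Set ℕ}
  {Y : Fin m → ℕ → EuclideanSpace ℝ (Fin m)}

/-- Error made in the partial gradients when using outdated information. -/
theorem outdated_gradient_error
    (hLip : ∀ y z, ‖gradient f z - gradient f y‖ ≤ L * ‖z - y‖)
    (hstep : ∀ t c, x (t + 1) c = x t c + γ * s t c)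
    (hY : ∀ c t, t ∈ A c → ∀ c', ∃ t' ≤ t, t < t' + B ∧ Y c t c' = x t' c')
    {k t t₀ : ℕ} {c : Fin m} (ht : t ∈ Finset.Ico (k * B) ((k + 1) * B))
    (ht₀ : t₀ ∈ Finset.Ico (k * B) ((k + 1) * B)) (hA : t ∈ A c) :
    (gradient f (x t₀) c - gradient f (Y c t) c) ^ 2 ≤
      2 * B * L ^ 2 * γ ^ 2 * ∑ r ∈ Finset.Ico ((k - 1) * B) ((k + 1) * B), ‖s r‖ ^ 2 := by
  rw [Finset.mem_Ico] at ht ht₀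
  have hk : (k - 1) * B = k * B - B := Nat.sub_one_mul k B
  have hk2 : (k + 1) * B = k * B + B := Nat.succ_mul k B
  have hdist := norm_sub_sq_le_window_sum hstep (p := (k - 1) * B) (q := (k + 1) * B) (a := t₀)
    (by omega) (by omega) (y := Y c t) fun c' => by
      obtain ⟨t', h1, h2, h3⟩ := hY c t hA c'
      exact ⟨t', by omega, by omega, h3⟩
  have hlen : (((k + 1) * B - (k - 1) * B : ℕ) : ℝ) ≤ 2 * B := by
    exact_mod_cast (by omega : (k + 1) * B - (k - 1) * B ≤ 2 * B)
  have hcoord : (gradient f (x t₀) c - gradient f (Y c t) c) ^ 2 ≤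
      ‖gradient f (x t₀) - gradient f (Y c t)‖ ^ 2 := by
    have h := PiLp.norm_apply_le (gradient f (x t₀) - gradient f (Y c t)) c
    rw [Real.norm_eq_abs, PiLp.sub_apply] at h
    rw [← sq_abs]
    exact pow_le_pow_left₀ (abs_nonneg _) h 2
  have hlip : ‖gradient f (x t₀) - gradient f (Y c t)‖ ^ 2 ≤ L ^ 2 * ‖x t₀ - Y c t‖ ^ 2 := by
    rw [← mul_pow]
    exact pow_le_pow_left₀ (norm_nonneg _) (hLip _ _) 2
  have hsum : 0 ≤ ∑ r ∈ Finset.Ico ((k - 1) * B) ((k + 1) * B), ‖s r‖ ^ 2 :=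
    Finset.sum_nonneg fun _ _ => sq_nonneg _
  calc _ ≤ L ^ 2 * ‖x t₀ - Y c t‖ ^ 2 := hcoord.trans hlip
    _ ≤ L ^ 2 * (γ ^ 2 * (2 * B * ∑ r ∈ Finset.Ico ((k - 1) * B) ((k + 1) * B), ‖s r‖ ^ 2)) := by
      refine mul_le_mul_of_nonneg_left (hdist.trans ?_) (sq_nonneg L)
      exact mul_le_mul_of_nonneg_left (mul_le_mul_of_nonneg_right hlen hsum) (sq_nonneg γ)
    _ = _ := by ring

/-- Decrease of `f` over a window of length `B`. -/
theorem window_descent (hL : 0 ≤ L) (hdiff : Differentiable ℝ f)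
    (hLip : ∀ y z, ‖gradient f z - gradient f y‖ ≤ L * ‖z - y‖)
    (hstep : ∀ t c, x (t + 1) c = x t c + γ * s t c)
    (hs : ∀ t c, s t c = if t ∈ A c then -(gradient f (Y c t) c) else 0)
    (hY : ∀ c t, t ∈ A c → ∀ c', ∃ t' ≤ t, t < t' + B ∧ Y c t c' = x t' c') (k : ℕ) :
    f (x ((k + 1) * B)) - f (x (k * B)) ≤
      (-γ + γ ^ 2 * (1 / 2 + L)) * ∑ t ∈ Finset.Ico (k * B) ((k + 1) * B), ‖s t‖ ^ 2 +
      B * (m * (B * L ^ 2 * γ ^ 2 *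
        ∑ r ∈ Finset.Ico ((k - 1) * B) ((k + 1) * B), ‖s r‖ ^ 2)) := by
  set P := ∑ r ∈ Finset.Ico ((k - 1) * B) ((k + 1) * B), ‖s r‖ ^ 2 with hPdef
  have hP : 0 ≤ P := Finset.sum_nonneg fun _ _ => sq_nonneg _
  have hone : ∀ t ∈ Finset.Ico (k * B) ((k + 1) * B), f (x (t + 1)) - f (x t) ≤
      (-γ + γ ^ 2 * (1 / 2 + L)) * ‖s t‖ ^ 2 + m * (B * L ^ 2 * γ ^ 2 * P) := by
    intro t ht
    have hx : x (t + 1) = x t + γ • s t := by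
      ext c; simpa using hstep t c
    have h := inexact_gradient_step (γ := γ) (E := 2 * B * L ^ 2 * γ ^ 2 * P) hL (by positivity) hdiff
      hLip (y := x t) (d := s t) fun c => by
        rw [hs t c]
        split_ifs with hA
        · right
          rw [← sub_eq_add_neg]
          exact outdated_gradient_error hLip hstep hY ht ht hA
        · exact Or.inl rfl
    rw [hx]
    linarith
  have h := Finset.sum_le_sum hone
  rw [Finset.sum_Ico_sub (fun t => f (x t)) (Nat.mul_le_mul_right B k.le_succ),
    Finset.sum_add_distrib, ← Finset.mul_sum, Finset.sum_const, Nat.card_Ico, nsmul_eq_mul,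
    Nat.succ_mul, Nat.add_sub_cancel_left] at h
  rwa [Nat.succ_mul]

/-- The gradient at the start of a window is controlled by the updates made in it. -/
theorem window_gradient_bound (hB : 1 ≤ B) (hγ : 0 < γ) (hγ1 : γ ≤ 1)
    (hLip : ∀ y z, ‖gradient f z - gradient f y‖ ≤ L * ‖z - y‖)
    (hstep : ∀ t c, x (t + 1) c = x t c + γ * s t c)
    (hs : ∀ t c, s t c = if t ∈ A c then -(gradient f (Y c t) c) else 0)
    (hY : ∀ c t, t ∈ A c → ∀ c', ∃ t' ≤ t, t < t' + B ∧ Y c t c' = x t' c')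
    (hA : ∀ c t, ∃ t' ∈ Finset.Ico t (t + B), t' ∈ A c) (k : ℕ) :
    ‖gradient f (x (k * B))‖ ^ 2 ≤
      (1 + γ) * ∑ t ∈ Finset.Ico (k * B) ((k + 1) * B), ‖s t‖ ^ 2 +
      m * (4 * B * L ^ 2 * γ *
        ∑ r ∈ Finset.Ico ((k - 1) * B) ((k + 1) * B), ‖s r‖ ^ 2) := by
  set P := ∑ r ∈ Finset.Ico ((k - 1) * B) ((k + 1) * B), ‖s r‖ ^ 2 with hPdef
  have hP : 0 ≤ P := Finset.sum_nonneg fun _ _ => sq_nonneg _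
  have hcoord : ∀ c, gradient f (x (k * B)) c ^ 2 ≤
      (1 + γ) * ∑ t ∈ Finset.Ico (k * B) ((k + 1) * B), s t c ^ 2 +
        4 * B * L ^ 2 * γ * P := by
    intro c
    obtain ⟨t, ht, htA⟩ := hA c (k * B)
    rw [← Nat.succ_mul] at ht
    have herr := outdated_gradient_error hLip hstep hY ht
      (Finset.left_mem_Ico.2 (Nat.mul_lt_mul_of_pos_right k.lt_succ_self hB)) htA
    rw [← hPdef] at herr
    have hsingle : s t c ^ 2 ≤ ∑ t ∈ Finset.Ico (k * B) ((k + 1) * B), s t c ^ 2 :=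
      Finset.single_le_sum (f := fun t => s t c ^ 2) (fun _ _ => sq_nonneg _) ht
    have hst : s t c = -(gradient f (Y c t) c) := by rw [hs, if_pos htA]
    set g := gradient f (x (k * B)) c
    set g' := gradient f (Y c t) c
    have hyoung : γ * g ^ 2 ≤ γ * ((1 + γ) * g' ^ 2) + (1 + γ) * (g - g') ^ 2 := by
      nlinarith [sq_nonneg (γ * g' - (g - g'))]
    have herr' : (1 + γ) * (g - g') ^ 2 ≤ γ * (4 * B * L ^ 2 * γ * P) := by
      calc (1 + γ) * (g - g') ^ 2 ≤ 2 * (2 * B * L ^ 2 * γ ^ 2 * P) :=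
            mul_le_mul (by linarith) herr (sq_nonneg _) (by norm_num)
        _ = _ := by ring
    have hg : g ^ 2 ≤ (1 + γ) * g' ^ 2 + 4 * B * L ^ 2 * γ * P :=
      le_of_mul_le_mul_left (by linarith) hγ
    have hg' : (1 + γ) * g' ^ 2 ≤
        (1 + γ) * ∑ t ∈ Finset.Ico (k * B) ((k + 1) * B), s t c ^ 2 := by
      rw [hst, neg_sq] at hsingle
      exact mul_le_mul_of_nonneg_left hsingle (by linarith)
    linarith
  have h := Finset.sum_le_sum fun c (_ : c ∈ Finset.univ) => hcoord c
  rw [Finset.sum_add_distrib, ← Finset.mul_sum, Finset.sum_comm] at h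
  simpa only [← EuclideanSpace.real_norm_sq_eq, Finset.sum_const, Finset.card_univ,
    Fintype.card_fin, nsmul_eq_mul] using h

end Window

theorem async_bcd_linear_convergence_PL
    (m n B : ℕ) (hn : 0 < n) (hB : 1 ≤ B)
    (f : EuclideanSpace ℝ (Fin m) → ℝ) (μ L fstar : ℝ)
    (hμ : 0 < μ) (hL : 0 < L)
    (hdiff : Differentiable ℝ f)
    (hmin : ∀ z, fstar ≤ f z) (hattain : ∃ z, f z = fstar)
    (hPL : ∀ z, μ * (f z - fstar) ≤ (1 / 2) * ‖gradient f z‖ ^ 2)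
    (hLip : ∀ y z, ‖gradient f z - gradient f y‖ ≤ L * ‖z - y‖)
    (hstatfin : {z : EuclideanSpace ℝ (Fin m) | gradient f z = 0}.Finite)
    (hstatne : {z : EuclideanSpace ℝ (Fin m) | gradient f z = 0}.Nonempty) :
    ∃ γ₀ : ℝ, 0 < γ₀ ∧ γ₀ < 1 ∧
      ∀ γ : ℝ, 0 < γ → γ < γ₀ →
      ∀ (blk : Fin m → Fin n) (T : Fin n → Set ℕ) (τ : Fin n → Fin n → ℕ → ℕ)
        (X : Fin n → ℕ → EuclideanSpace ℝ (Fin m))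
        (x s : ℕ → EuclideanSpace ℝ (Fin m)),
        (∀ i j t, τ i j t ≤ t) →
        (∀ i j, j ≠ i → ∀ t c, blk c = j → X i t c = X j (τ i j t) c) →
        (∀ i t c, blk c = i →
          X i (t + 1) c = if t ∈ T i then X i t c - γ * gradient f (X i t) c else X i t c) →
        (∀ t c, x t c = X (blk c) t c) →
        (∀ t c, s t c = if t ∈ T (blk c) then -(gradient f (X (blk c) t) c) else 0) →
        (∀ i t, ∃ t' ∈ Finset.Ico t (t + B), t' ∈ T i) →
        (∀ i j t, t ∈ T i → j ≠ i → t < τ i j t + B) →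
        ∃ η : ℝ, 0 < η ∧ ∀ k : ℕ,
          f (x (k * B)) - fstar ≤ (1 - γ * μ) ^ (k - 1) * η ∧
          γ ^ 2 * ∑ τ' ∈ Finset.Ico ((k - 1) * B) (k * B), ‖s τ'‖ ^ 2 ≤
            (1 - γ * μ) ^ (k - 1) * η := by
  set C : ℝ := 1 + L + m * B * L ^ 2 * (B + 4) with hCdef
  have hC : 0 < C := by positivity
  have hden : 0 < 2 + 2 * μ + 12 * C := by positivity
  refine ⟨1 / (2 + 2 * μ + 12 * C), by positivity, by rw [div_lt_one hden]; linarith, ?_⟩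
  intro γ hγ hγ₀ blk T τ X x s hτ hX hupd hx hs hT hdelay
  rw [lt_div_iff₀ hden] at hγ₀
  have hγμ : 0 < γ * μ := mul_pos hγ hμ
  have hγC : 0 < γ * C := mul_pos hγ hC
  have hstep : ∀ t c, x (t + 1) c = x t c + γ * s t c := by
    intro t c
    rw [hx, hx, hs, hupd _ _ _ rfl]
    split_ifs <;> ring
  have hY : ∀ c t, t ∈ T (blk c) → ∀ c', ∃ t' ≤ t, t < t' + B ∧ X (blk c) t c' = x t' c' := by
    intro c t ht c'
    by_cases h : blk c' = blk c
    · exact ⟨t, le_rfl, by omega, by rw [hx, h]⟩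
    · exact ⟨τ (blk c) (blk c') t, hτ _ _ _, hdelay _ _ _ ht h, by rw [hX _ _ h t c' rfl, hx]⟩
  let S : ℕ → ℝ := fun k => ∑ r ∈ Finset.Ico ((k - 1) * B) (k * B), ‖s r‖ ^ 2
  let F : ℕ → ℝ := fun k => f (x (k * B)) - fstar
  have hS : ∀ k, 0 ≤ S k := fun k => Finset.sum_nonneg fun _ _ => sq_nonneg _
  have hF : ∀ k, 0 ≤ F k := fun k => sub_nonneg.2 (hmin _)
  have hrec : ∀ k, F (k + 1) + γ / 4 * S (k + 1) ≤ (1 - γ * μ) * (F k + γ / 4 * S k) := by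
    intro k
    have hsplit : ∑ r ∈ Finset.Ico ((k - 1) * B) ((k + 1) * B), ‖s r‖ ^ 2 = S k + S (k + 1) :=
      (Finset.sum_Ico_consecutive _ (Nat.mul_le_mul_right B (Nat.sub_le k 1))
        (Nat.mul_le_mul_right B k.le_succ)).symm
    have hdesc := window_descent (A := fun c => T (blk c)) (Y := fun c => X (blk c)) hL.le
      hdiff hLip hstep hs hY k
    have hgrad := window_gradient_bound (A := fun c => T (blk c)) (Y := fun c => X (blk c))
      hB hγ (by nlinarith) hLip hstep hs hY (fun c t => hT (blk c) t) k
    rw [hsplit, show ∑ t ∈ Finset.Ico (k * B) ((k + 1) * B), ‖s t‖ ^ 2 = S (k + 1) from rfl]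
      at hdesc hgrad
    have hSk := hS k
    have hSk' := hS (k + 1)
    refine lyapunov_step (C := C) hSk hSk' hγ (by nlinarith) (by nlinarith) ?_ ?_
    · have h : γ ^ 2 * (1 / 2 + L) * S (k + 1) +
          B * (m * (B * L ^ 2 * γ ^ 2 * (S k + S (k + 1)))) ≤
          C * γ ^ 2 * (S k + S (k + 1)) := by
        have : 0 ≤ γ ^ 2 * ((1 / 2) * S (k + 1) + (1 + L) * S k +
          m * B * L ^ 2 * 4 * (S k + S (k + 1))) := by positivity
        rw [hCdef]; linarith
      simp only [F]
      linarith
    · have h : γ * S (k + 1) + m * (4 * B * L ^ 2 * γ * (S k + S (k + 1))) ≤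
          C * γ * (S k + S (k + 1)) := by
        have : 0 ≤ γ * (L * S (k + 1) + (1 + L) * S k +
          m * B * L ^ 2 * B * (S k + S (k + 1))) := by positivity
        rw [hCdef]; linarith
      have := hPL (x (k * B))
      simp only [F]
      linarith
  have hρ : 0 ≤ 1 - γ * μ := by nlinarith
  have hV : ∀ k, F k + γ / 4 * S k ≤ (1 - γ * μ) ^ k * F 0 := by
    intro k
    induction k with
    | zero => simp [S]
    | succ k ih =>
      calc _ ≤ (1 - γ * μ) * (F k + γ / 4 * S k) := hrec k
        _ ≤ (1 - γ * μ) * ((1 - γ * μ) ^ k * F 0) := mul_le_mul_of_nonneg_left ih hρ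
        _ = _ := by ring
  refine ⟨4 * F 0 + 1, by linarith [hF 0], fun k => ?_⟩
  have hpow : (1 - γ * μ) ^ k ≤ (1 - γ * μ) ^ (k - 1) :=
    pow_le_pow_of_le_one hρ (by linarith) (Nat.sub_le k 1)
  have hVk : 4 * (F k + γ / 4 * S k) ≤ (1 - γ * μ) ^ (k - 1) * (4 * F 0 + 1) := by
    have h1 := mul_le_mul_of_nonneg_right hpow (hF 0)
    have h2 : 0 ≤ (1 - γ * μ) ^ (k - 1) := pow_nonneg hρ _
    linarith [hV k]
  have hγS : 0 ≤ γ * S k := mul_nonneg hγ.le (hS k)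
  refine ⟨?_, ?_⟩
  · change F k ≤ _
    linarith [hF k]
  · change γ ^ 2 * S k ≤ _
    have : γ * (γ * S k) ≤ γ * S k := mul_le_of_le_one_left hγS (by nlinarith)
    linarith [hF k]
end

section
/- For all t ≥ 0, the one-step decrease of the objective along the true state satisfies f(x(t+1)) − f(x(t)) ≤ (L/2)γ² [ B‖s(t)‖² + n Σ_{τ=t−B}^{t−1} ‖s(τ)‖² ] + (Lγ² − γ)‖s(t)‖². -/
open scoped BigOperators
open Classical

/-- The descent lemma for functions with Lipschitz gradient. -/
theorem descent_lemma {E : Type*} [NormedAddCommGroup E] [InnerProductSpace ℝ E] [CompleteSpace E]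
    {f : E → ℝ} {L : ℝ} (hf : Differentiable ℝ f)
    (hLip : ∀ y z, ‖gradient f z - gradient f y‖ ≤ L * ‖z - y‖) (x v : E) :
    f (x + v) - f x ≤ inner ℝ (gradient f x) v + L / 2 * ‖v‖ ^ 2 := by
  let g : ℝ → ℝ := fun r => f (x + r • v) - r * inner ℝ (gradient f x) v - L / 2 * ‖v‖ ^ 2 * r ^ 2
  have hg : ∀ r, HasDerivAt g (inner ℝ (gradient f (x + r • v)) v - inner ℝ (gradient f x) v
      - L * ‖v‖ ^ 2 * r) r := by
    intro r
    have hline : HasDerivAt (fun r : ℝ => x + r • v) v r := by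
      simpa using ((hasDerivAt_id r).smul_const v).const_add x
    have hcomp : HasDerivAt (fun r : ℝ => f (x + r • v))
        (inner ℝ (gradient f (x + r • v)) v) r := by
      have := (hf (x + r • v)).hasGradientAt.hasFDerivAt.comp_hasDerivAt r hline
      simpa [Function.comp_def] using this
    refine ((hcomp.sub ((hasDerivAt_id r).mul_const (inner ℝ (gradient f x) v))).sub
      ((hasDerivAt_pow 2 r).const_mul (L / 2 * ‖v‖ ^ 2))).congr_deriv ?_
    norm_num
    ring
  have hanti : AntitoneOn g (Set.Icc 0 1) := by
    refine antitoneOn_of_deriv_nonpos (convex_Icc 0 1)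
      (fun r _ => (hg r).continuousAt.continuousWithinAt)
      (fun r _ => (hg r).differentiableAt.differentiableWithinAt) fun r hr => ?_
    rw [interior_Icc] at hr
    rw [(hg r).deriv, ← inner_sub_left]
    have h1 := real_inner_le_norm (gradient f (x + r • v) - gradient f x) v
    have h2 := hLip x (x + r • v)
    rw [add_sub_cancel_left, norm_smul, Real.norm_of_nonneg hr.1.le] at h2
    nlinarith [mul_le_mul_of_nonneg_right h2 (norm_nonneg v)]
  have h := hanti (Set.left_mem_Icc.2 zero_le_one) (Set.right_mem_Icc.2 zero_le_one) zero_le_one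
  simp only [g, one_smul, zero_smul, add_zero] at h
  linarith

/-- The vector that agrees with `v` on the coordinates satisfying `p` and vanishes elsewhere. -/
noncomputable def coordRestrict {ι : Type*} (p : ι → Prop) (v : EuclideanSpace ℝ ι) :
    EuclideanSpace ℝ ι :=
  WithLp.toLp 2 fun c => if p c then v c else 0

@[simp]
theorem coordRestrict_apply {ι : Type*} (p : ι → Prop) (v : EuclideanSpace ℝ ι) (c : ι) :
    coordRestrict p v c = if p c then v c else 0 := rfl

theorem norm_coordRestrict_le {ι : Type*} [Fintype ι] (p : ι → Prop) (v : EuclideanSpace ℝ ι) :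
    ‖coordRestrict p v‖ ≤ ‖v‖ := by
  rw [EuclideanSpace.norm_eq, EuclideanSpace.norm_eq]
  gcongr with c
  rw [coordRestrict_apply]
  split_ifs <;> simp

theorem sum_norm_sq_coordRestrict_fiber {ι κ : Type*} [Fintype ι] [Fintype κ] (blk : ι → κ)
    (v : EuclideanSpace ℝ ι) :
    ∑ i, ‖coordRestrict (fun c => blk c = i) v‖ ^ 2 = ‖v‖ ^ 2 := by
  simp only [EuclideanSpace.norm_sq_eq, coordRestrict_apply]
  rw [Finset.sum_comm]
  refine Finset.sum_congr rfl fun c _ => ?_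
  rw [Finset.sum_eq_single (blk c)] <;> simp +contextual [eq_comm]

theorem sum_coordRestrict_fiber {ι κ : Type*} [Fintype κ] (blk : ι → κ)
    (v : EuclideanSpace ℝ ι) :
    ∑ i, coordRestrict (fun c => blk c = i) v = v := by
  ext c
  simp

/-- Young's inequality summed over pairs of indices. -/
theorem sum_mul_sum_le_half_card_mul_sq {ι κ : Type*} (I : Finset ι) (J : Finset κ)
    (a : ι → ℝ) (b : κ → ℝ) :
    ∑ i ∈ I, (∑ j ∈ J, b j) * a i ≤
      (1 / 2) * (J.card * ∑ i ∈ I, a i ^ 2 + I.card * ∑ j ∈ J, b j ^ 2) := by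
  calc ∑ i ∈ I, (∑ j ∈ J, b j) * a i
      ≤ ∑ i ∈ I, ∑ j ∈ J, (1 / 2) * (a i ^ 2 + b j ^ 2) := by
        refine Finset.sum_le_sum fun i _ => ?_
        rw [Finset.sum_mul]
        refine Finset.sum_le_sum fun j _ => ?_
        nlinarith [sq_nonneg (a i - b j)]
    _ = _ := by
        simp only [← Finset.mul_sum, Finset.sum_add_distrib, Finset.sum_const, nsmul_eq_mul]

theorem one_step_decrease
    (m n B : ℕ) (hn : 0 < n) (hB : 1 ≤ B)
    (f : EuclideanSpace ℝ (Fin m) → ℝ) (μ L γ fstar : ℝ)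
    (hμ : 0 < μ) (hL : 0 < L) (hγ : 0 < γ)
    (hdiff : Differentiable ℝ f)
    (hmin : ∀ z, fstar ≤ f z) (hattain : ∃ z, f z = fstar)
    (hPL : ∀ z, μ * (f z - fstar) ≤ (1 / 2) * ‖gradient f z‖ ^ 2)
    (hLip : ∀ y z, ‖gradient f z - gradient f y‖ ≤ L * ‖z - y‖)
    (hstatfin : {z : EuclideanSpace ℝ (Fin m) | gradient f z = 0}.Finite)
    (hstatne : {z : EuclideanSpace ℝ (Fin m) | gradient f z = 0}.Nonempty)
    (blk : Fin m → Fin n) (T : Fin n → Set ℕ) (τ : Fin n → Fin n → ℕ → ℕ)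
    (X : Fin n → ℕ → EuclideanSpace ℝ (Fin m))
    (x s : ℕ → EuclideanSpace ℝ (Fin m))
    (hτle : ∀ i j t, τ i j t ≤ t)
    (hread : ∀ i j, j ≠ i → ∀ t c, blk c = j → X i t c = X j (τ i j t) c)
    (hupd : ∀ i t c, blk c = i →
      X i (t + 1) c = if t ∈ T i then X i t c - γ * gradient f (X i t) c else X i t c)
    (hx : ∀ t c, x t c = X (blk c) t c)
    (hs : ∀ t c, s t c = if t ∈ T (blk c) then -(gradient f (X (blk c) t) c) else 0)
    (hasync1 : ∀ i t, ∃ t' ∈ Finset.Ico t (t + B), t' ∈ T i)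
    (hasync2 : ∀ i j t, t ∈ T i → j ≠ i → t < τ i j t + B)
    :
    ∀ t : ℕ,
      f (x (t + 1)) - f (x t) ≤
        (L / 2) * γ ^ 2 * ((B : ℝ) * ‖s t‖ ^ 2 +
          (n : ℝ) * ∑ τ' ∈ Finset.Ico (t - B) t, ‖s τ'‖ ^ 2) +
        (L * γ ^ 2 - γ) * ‖s t‖ ^ 2 := by
  intro t
  have hstep : ∀ t, x (t + 1) = x t + γ • s t := by
    intro t
    ext c
    rw [PiLp.add_apply, PiLp.smul_apply, smul_eq_mul, hx, hx, hs, hupd _ _ _ rfl]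
    split_ifs <;> ring
  have htel : ∀ t₀ t₁, t₀ ≤ t₁ → x t₁ = x t₀ + γ • ∑ k ∈ Finset.Ico t₀ t₁, s k := by
    intro t₀ t₁ h
    induction t₁, h using Nat.le_induction with
    | base => simp
    | succ k hk ih => rw [hstep, ih, Finset.sum_Ico_succ_top hk, smul_add, add_assoc]
  set W := Finset.Ico (t - B) t
  let σ : Fin n → EuclideanSpace ℝ (Fin m) := fun i => coordRestrict (fun c => blk c = i) (s t)
  have hstale : ∀ i, t ∈ T i → ‖x t - X i t‖ ≤ γ * ∑ k ∈ W, ‖s k‖ := by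
    intro i hi
    have heq : x t - X i t =
        γ • ∑ k ∈ W, coordRestrict (fun c => blk c ≠ i ∧ τ i (blk c) t ≤ k) (s k) := by
      ext c
      by_cases hc : blk c = i
      · simp [hx, hc]
      have hsub : W.filter (fun k => τ i (blk c) t ≤ k) = Finset.Ico (τ i (blk c) t) t := by
        ext k
        have := hasync2 i (blk c) t hi hc
        simp only [W, Finset.mem_filter, Finset.mem_Ico]
        omega
      rw [PiLp.sub_apply, hread i (blk c) hc t c rfl, ← hx, htel _ t (hτle i (blk c) t)]
      simp [hc, ← Finset.sum_filter, hsub]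
    rw [heq, norm_smul, Real.norm_of_nonneg hγ.le]
    gcongr
    exact (norm_sum_le _ _).trans (Finset.sum_le_sum fun k _ => norm_coordRestrict_le _ _)
  have hblock : ∀ i, inner ℝ (gradient f (x t)) (σ i) ≤
      L * γ * ((∑ k ∈ W, ‖s k‖) * ‖σ i‖) - ‖σ i‖ ^ 2 := by
    intro i
    by_cases hi : t ∈ T i
    · have hself : inner ℝ (gradient f (X i t)) (σ i) = -‖σ i‖ ^ 2 := by
        rw [← real_inner_self_eq_norm_sq, ← inner_neg_left]
        simp only [PiLp.inner_apply]
        refine Finset.sum_congr rfl fun c _ => ?_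
        by_cases hc : blk c = i
        · simp [σ, hc, hs, hi]
        · simp [σ, hc]
      have h1 := real_inner_le_norm (gradient f (x t) - gradient f (X i t)) (σ i)
      have h2 := (hLip (X i t) (x t)).trans (mul_le_mul_of_nonneg_left (hstale i hi) hL.le)
      have h3 := mul_le_mul_of_nonneg_right h2 (norm_nonneg (σ i))
      rw [inner_sub_left, hself] at h1
      linarith
    · have hzero : σ i = 0 := by
        ext c
        by_cases hc : blk c = i <;> simp [σ, hc, hs, hi]
      simp [hzero]
  have hinner : inner ℝ (gradient f (x t)) (s t) ≤
      L * γ * ((1 / 2) * (B * ‖s t‖ ^ 2 + n * ∑ k ∈ W, ‖s k‖ ^ 2)) - ‖s t‖ ^ 2 := by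
    have hcard : (W.card : ℝ) ≤ B := by
      simp only [W, Nat.card_Ico]
      exact_mod_cast (by omega : t - (t - B) ≤ B)
    have hyoung := sum_mul_sum_le_half_card_mul_sq Finset.univ W (fun i => ‖σ i‖) (fun k => ‖s k‖)
    have hσ : ∑ i, ‖σ i‖ ^ 2 = ‖s t‖ ^ 2 := sum_norm_sq_coordRestrict_fiber blk (s t)
    rw [hσ, Finset.card_univ, Fintype.card_fin] at hyoung
    calc inner ℝ (gradient f (x t)) (s t)
        = ∑ i, inner ℝ (gradient f (x t)) (σ i) := by
          rw [← inner_sum, sum_coordRestrict_fiber]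
      _ ≤ ∑ i, (L * γ * ((∑ k ∈ W, ‖s k‖) * ‖σ i‖) - ‖σ i‖ ^ 2) :=
          Finset.sum_le_sum fun i _ => hblock i
      _ = L * γ * ∑ i, (∑ k ∈ W, ‖s k‖) * ‖σ i‖ - ‖s t‖ ^ 2 := by
          rw [Finset.sum_sub_distrib, ← Finset.mul_sum, hσ]
      _ ≤ _ := by
          gcongr
          refine hyoung.trans ?_
          gcongr
  have hdesc := descent_lemma hdiff hLip (x t) (γ • s t)
  rw [← hstep, inner_smul_right, norm_smul, Real.norm_of_nonneg hγ.le] at hdesc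
  have hscaled := mul_le_mul_of_nonneg_left hinner hγ.le
  have hslack : 0 ≤ L * γ ^ 2 * ‖s t‖ ^ 2 := by positivity
  linarith
end

section
/- For all t ≥ 0, the B-step decrease of the objective along the true state satisfies f(x(t+B)) − f(x(t)) ≤ (L/2)γ²nB Σ_{τ=t−B}^{t−1} ‖s(τ)‖² + ( γ²L( (B/2)(n+1) + 1 ) − γ ) Σ_{τ=t}^{t+B−1} ‖s(τ)‖². -/
open scoped BigOperators
open Classical

/-- Quadratic upper bound for a function with `L`-Lipschitz gradient. -/
theorem le_add_inner_gradient_add_sq {E : Type*} [NormedAddCommGroup E] [InnerProductSpace ℝ E]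
    [CompleteSpace E] {f : E → ℝ} {L : ℝ} (hdiff : Differentiable ℝ f)
    (hLip : ∀ y z, ‖gradient f z - gradient f y‖ ≤ L * ‖z - y‖) (x v : E) :
    f (x + v) ≤ f x + inner ℝ (gradient f x) v + L / 2 * ‖v‖ ^ 2 := by
  let φ : ℝ → ℝ := fun u => f (x + u • v) - u * inner ℝ (gradient f x) v - L / 2 * u ^ 2 * ‖v‖ ^ 2
  have hφ (u : ℝ) : HasDerivAt φ (inner ℝ (gradient f (x + u • v)) v - inner ℝ (gradient f x) v
      - L * u * ‖v‖ ^ 2) u := by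
    have hline : HasDerivAt (fun u : ℝ => x + u • v) v u := by
      simpa using ((hasDerivAt_id u).smul_const v).const_add x
    have hcomp : HasDerivAt (fun u : ℝ => f (x + u • v))
        (inner ℝ (gradient f (x + u • v)) v) u := by
      have h := (hdiff (x + u • v)).hasGradientAt.hasFDerivAt.comp_hasDerivAt u hline
      rwa [InnerProductSpace.toDual_apply_apply] at h
    refine ((hcomp.sub ((hasDerivAt_id u).mul_const (inner ℝ (gradient f x) v))).sub
      (((hasDerivAt_pow 2 u).const_mul (L / 2)).mul_const (‖v‖ ^ 2))).congr_deriv ?_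
    push_cast
    ring
  have hanti : AntitoneOn φ (Set.Icc 0 1) := by
    refine antitoneOn_of_deriv_nonpos (convex_Icc 0 1)
      (fun u _ => (hφ u).continuousAt.continuousWithinAt)
      (fun u _ => (hφ u).differentiableAt.differentiableWithinAt) fun u hu => ?_
    rw [interior_Icc] at hu
    rw [(hφ u).deriv, ← inner_sub_left]
    have hnorm : ‖gradient f (x + u • v) - gradient f x‖ ≤ L * (u * ‖v‖) := by
      simpa [norm_smul, abs_of_pos hu.1] using hLip x (x + u • v)
    have := real_inner_le_norm (gradient f (x + u • v) - gradient f x) v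
    nlinarith [mul_le_mul_of_nonneg_right hnorm (norm_nonneg v)]
  have h := hanti (Set.left_mem_Icc.2 zero_le_one) (Set.right_mem_Icc.2 zero_le_one) zero_le_one
  simp only [φ, one_smul, zero_smul, add_zero] at h
  linarith

theorem B_step_decrease
    (m n B : ℕ) (hn : 0 < n) (hB : 1 ≤ B)
    (f : EuclideanSpace ℝ (Fin m) → ℝ) (μ L γ fstar : ℝ)
    (hμ : 0 < μ) (hL : 0 < L) (hγ : 0 < γ)
    (hdiff : Differentiable ℝ f)
    (hmin : ∀ z, fstar ≤ f z) (hattain : ∃ z, f z = fstar)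
    (hPL : ∀ z, μ * (f z - fstar) ≤ (1 / 2) * ‖gradient f z‖ ^ 2)
    (hLip : ∀ y z, ‖gradient f z - gradient f y‖ ≤ L * ‖z - y‖)
    (hstatfin : {z : EuclideanSpace ℝ (Fin m) | gradient f z = 0}.Finite)
    (hstatne : {z : EuclideanSpace ℝ (Fin m) | gradient f z = 0}.Nonempty)
    (blk : Fin m → Fin n) (T : Fin n → Set ℕ) (τ : Fin n → Fin n → ℕ → ℕ)
    (X : Fin n → ℕ → EuclideanSpace ℝ (Fin m))
    (x s : ℕ → EuclideanSpace ℝ (Fin m))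
    (hτle : ∀ i j t, τ i j t ≤ t)
    (hread : ∀ i j, j ≠ i → ∀ t c, blk c = j → X i t c = X j (τ i j t) c)
    (hupd : ∀ i t c, blk c = i →
      X i (t + 1) c = if t ∈ T i then X i t c - γ * gradient f (X i t) c else X i t c)
    (hx : ∀ t c, x t c = X (blk c) t c)
    (hs : ∀ t c, s t c = if t ∈ T (blk c) then -(gradient f (X (blk c) t) c) else 0)
    (hasync1 : ∀ i t, ∃ t' ∈ Finset.Ico t (t + B), t' ∈ T i)
    (hasync2 : ∀ i j t, t ∈ T i → j ≠ i → t < τ i j t + B)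
    :
    ∀ t : ℕ,
      f (x (t + B)) - f (x t) ≤
        (L / 2) * γ ^ 2 * (n : ℝ) * (B : ℝ) * ∑ τ' ∈ Finset.Ico (t - B) t, ‖s τ'‖ ^ 2 +
        (γ ^ 2 * L * (((B : ℝ) / 2) * ((n : ℝ) + 1) + 1) - γ) *
          ∑ τ' ∈ Finset.Ico t (t + B), ‖s τ'‖ ^ 2 := by
  intro t
  have hstep (t : ℕ) (c : Fin m) : x (t + 1) c = x t c + γ * s t c := by
    rw [hx, hx, hs, hupd _ _ _ rfl]
    split_ifs <;> ring
  have htele (c : Fin m) (t₀ k : ℕ) :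
      x (t₀ + k) c - x t₀ c = γ * ∑ r ∈ Finset.Ico t₀ (t₀ + k), s r c := by
    induction k with
    | zero => simp
    | succ k ih =>
      rw [← add_assoc, Finset.sum_Ico_succ_top (by omega), hstep]
      linarith
  have hB' : (0 : ℝ) < B := by exact_mod_cast hB
  have hnorm (v : EuclideanSpace ℝ (Fin m)) : ‖v‖ ^ 2 = ∑ c, v c ^ 2 :=
    EuclideanSpace.real_norm_sq_eq v
  -- staleness of the information read at an update
  have hstale (t : ℕ) (i : Fin n) (hi : t ∈ T i) :
      ‖x t - X i t‖ ^ 2 ≤ γ ^ 2 * B * ∑ r ∈ Finset.Ico (t - B) t, ‖s r‖ ^ 2 := by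
    simp_rw [hnorm]
    rw [Finset.sum_comm, Finset.mul_sum]
    refine Finset.sum_le_sum fun c _ => ?_
    rw [PiLp.sub_apply]
    by_cases hc : blk c = i
    · rw [hx, hc, sub_self, zero_pow two_ne_zero]
      exact mul_nonneg (by positivity) (Finset.sum_nonneg fun _ _ => sq_nonneg _)
    · have hwin := hasync2 i (blk c) t hi hc
      have hle := hτle i (blk c) t
      rw [hread i (blk c) hc t c rfl, ← hx]
      have h := htele c (τ i (blk c) t) (t - τ i (blk c) t)
      rw [Nat.add_sub_cancel' hle] at h
      rw [h, mul_pow, mul_assoc]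
      refine mul_le_mul_of_nonneg_left ?_ (sq_nonneg γ)
      refine sq_sum_le_card_mul_sum_sq.trans ?_
      refine mul_le_mul ?_ ?_ (by positivity) hB'.le
      · rw [Nat.card_Ico]
        exact_mod_cast (by omega : t - τ i (blk c) t ≤ B)
      · exact Finset.sum_le_sum_of_subset_of_nonneg
          (Finset.Ico_subset_Ico_left (by omega)) fun _ _ _ => sq_nonneg _
  have hcross (t : ℕ) (i : Fin n) :
      ∑ c with blk c = i, γ * (gradient f (x t) c * s t c) ≤
        L / 2 * γ ^ 2 * ∑ r ∈ Finset.Ico (t - B) t, ‖s r‖ ^ 2 +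
          ∑ c with blk c = i, (γ ^ 2 * L * B / 2 - γ) * s t c ^ 2 := by
    by_cases hi : t ∈ T i
    · have hgrad : ∑ c with blk c = i, (gradient f (x t) c - gradient f (X i t) c) ^ 2 ≤
          L ^ 2 * (γ ^ 2 * B * ∑ r ∈ Finset.Ico (t - B) t, ‖s r‖ ^ 2) := by
        calc ∑ c with blk c = i, (gradient f (x t) c - gradient f (X i t) c) ^ 2
            ≤ ∑ c, (gradient f (x t) c - gradient f (X i t) c) ^ 2 :=
              Finset.sum_le_sum_of_subset_of_nonneg (Finset.filter_subset _ _)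
                fun _ _ _ => sq_nonneg _
          _ = ‖gradient f (x t) - gradient f (X i t)‖ ^ 2 := by simp [hnorm]
          _ ≤ (L * ‖x t - X i t‖) ^ 2 := by
              gcongr
              exact hLip _ _
          _ ≤ _ := by
              rw [mul_pow]
              gcongr
              exact hstale t i hi
      have hyoung (c : Fin m) (hc : blk c = i) : γ * (gradient f (x t) c * s t c) ≤
          (2 * L * B)⁻¹ * (gradient f (x t) c - gradient f (X i t) c) ^ 2 +
            (γ ^ 2 * L * B / 2 - γ) * s t c ^ 2 := by
        have hsc : s t c = -(gradient f (X i t) c) := by rw [hs, hc, if_pos hi]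
        obtain ⟨d, hd⟩ : ∃ d, d = gradient f (x t) c - gradient f (X i t) c := ⟨_, rfl⟩
        have hgc : gradient f (x t) c = d - s t c := by rw [hsc, hd]; ring
        rw [← hd, hgc]
        have hsq : 0 ≤ (2 * L * B)⁻¹ * (d - γ * L * B * s t c) ^ 2 := by positivity
        have hexp : (2 * L * B)⁻¹ * (d - γ * L * B * s t c) ^ 2 =
            (2 * L * B)⁻¹ * d ^ 2 - γ * d * s t c + γ ^ 2 * L * B / 2 * s t c ^ 2 := by
          field_simp
          ring
        linarith
      calc ∑ c with blk c = i, γ * (gradient f (x t) c * s t c)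
          ≤ ∑ c with blk c = i, ((2 * L * B)⁻¹ *
              (gradient f (x t) c - gradient f (X i t) c) ^ 2 +
                (γ ^ 2 * L * B / 2 - γ) * s t c ^ 2) :=
            Finset.sum_le_sum fun c hc => hyoung c (Finset.mem_filter.1 hc).2
        _ ≤ _ := by
            rw [Finset.sum_add_distrib, ← Finset.mul_sum]
            refine add_le_add_left ?_ _
            refine (mul_le_mul_of_nonneg_left hgrad (by positivity)).trans_eq ?_
            field_simp
    · have hzero (c : Fin m) (hc : c ∈ Finset.univ.filter (blk · = i)) : s t c = 0 := by
        rw [hs, (Finset.mem_filter.1 hc).2, if_neg hi]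
      rw [Finset.sum_eq_zero fun (c : Fin m) hc => by rw [hzero c hc]; ring,
        Finset.sum_eq_zero fun (c : Fin m) hc => by rw [hzero c hc]; ring, add_zero]
      positivity
  have hdescent (t : ℕ) : f (x (t + 1)) - f (x t) ≤
      L / 2 * γ ^ 2 * n * ∑ r ∈ Finset.Ico (t - B) t, ‖s r‖ ^ 2 +
        (γ ^ 2 * L * ((B : ℝ) / 2 + 1) - γ) * ‖s t‖ ^ 2 := by
    have hxt : x (t + 1) = x t + γ • s t := by
      ext c
      simp [hstep]
    have h := le_add_inner_gradient_add_sq hdiff hLip (x t) (γ • s t)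
    have hsum := Finset.sum_le_sum fun i (_ : i ∈ Finset.univ) => hcross t i
    rw [Finset.sum_add_distrib, Finset.sum_fiberwise, Finset.sum_fiberwise, Finset.sum_const,
      Finset.card_univ, Fintype.card_fin, nsmul_eq_mul, ← Finset.mul_sum, ← Finset.mul_sum,
      ← hnorm] at hsum
    have hinner : inner ℝ (gradient f (x t)) (γ • s t) =
        γ * ∑ c, gradient f (x t) c * s t c := by
      rw [inner_smul_right, PiLp.inner_apply]
      simp [mul_comm]
    rw [← hxt, hinner, norm_smul, mul_pow, Real.norm_eq_abs, sq_abs] at h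
    have : 0 ≤ γ ^ 2 * L * ‖s t‖ ^ 2 := by positivity
    linarith
  have hsplit : ∑ r ∈ Finset.Ico (t - B) t, ‖s r‖ ^ 2 + ∑ r ∈ Finset.Ico t (t + B), ‖s r‖ ^ 2 =
      ∑ r ∈ Finset.Ico (t - B) (t + B), ‖s r‖ ^ 2 :=
    Finset.sum_Ico_consecutive _ (by omega) (by omega)
  have hsum : ∑ t' ∈ Finset.Ico t (t + B), (f (x (t' + 1)) - f (x t')) ≤
      ∑ t' ∈ Finset.Ico t (t + B), (L / 2 * γ ^ 2 * n *
        ∑ r ∈ Finset.Ico (t - B) (t + B), ‖s r‖ ^ 2 +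
          (γ ^ 2 * L * ((B : ℝ) / 2 + 1) - γ) * ‖s t'‖ ^ 2) := by
    refine Finset.sum_le_sum fun t' ht' => (hdescent t').trans ?_
    rw [Finset.mem_Ico] at ht'
    gcongr <;> omega
  rw [Finset.sum_Ico_sub (fun k => f (x k)) (by omega), Finset.sum_add_distrib, Finset.sum_const,
    Nat.card_Ico, Nat.add_sub_cancel_left, nsmul_eq_mul, ← Finset.mul_sum, ← hsplit] at hsum
  linarith
end

section
/- For all t ≥ 0, the one-step change in the true state satisfies ‖x(t+1) − x(t)‖² ≤ (n²Bγ⁴L² + γ²Ln) Σ_{τ=t−B}^{t−1} ‖s(τ)‖² + (γ² + γ⁴LnB) ‖∇f(x(t))‖². -/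
open scoped BigOperators
open Classical

/-- If a trajectory moves by `γ • s t` at time `t`, a vector assembled from coordinates of states
that are at most `B` steps old is close to the current state. -/
theorem norm_sq_stale_sub_le {m B t : ℕ} {γ : ℝ} {x s : ℕ → EuclideanSpace ℝ (Fin m)}
    (hstep : ∀ r, x (r + 1) - x r = γ • s r) (y : EuclideanSpace ℝ (Fin m))
    (hy : ∀ c, ∃ r ≤ t, t ≤ r + B ∧ y c = x r c) :
    ‖y - x t‖ ^ 2 ≤ γ ^ 2 * B * ∑ r ∈ Finset.Ico (t - B) t, ‖s r‖ ^ 2 := by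
  simp_rw [EuclideanSpace.real_norm_sq_eq]
  rw [Finset.sum_comm, Finset.mul_sum]
  refine Finset.sum_le_sum fun c _ => ?_
  obtain ⟨r, hrt, htr, hyr⟩ := hy c
  have htel : x t c - x r c = γ * ∑ k ∈ Finset.Ico r t, s k c := by
    rw [Finset.mul_sum, ← Finset.sum_Ico_sub (fun k => x k c) hrt]
    exact Finset.sum_congr rfl fun k _ => congrArg (fun v => v c) (hstep k)
  have hcard : ((Finset.Ico r t).card : ℝ) ≤ B := by
    rw [Nat.card_Ico]
    exact_mod_cast (by omega : t - r ≤ B)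
  have hsub : Finset.Ico r t ⊆ Finset.Ico (t - B) t :=
    Finset.Ico_subset_Ico (by omega) le_rfl
  calc (y - x t) c ^ 2 = (x t c - x r c) ^ 2 := by
        rw [PiLp.sub_apply, hyr]; ring
    _ = γ ^ 2 * (∑ k ∈ Finset.Ico r t, s k c) ^ 2 := by rw [htel, mul_pow]
    _ ≤ γ ^ 2 * ((Finset.Ico r t).card * ∑ k ∈ Finset.Ico r t, s k c ^ 2) := by
        gcongr
        exact sq_sum_le_card_mul_sum_sq
    _ ≤ γ ^ 2 * (B * ∑ k ∈ Finset.Ico (t - B) t, s k c ^ 2) := by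
        gcongr
    _ = _ := by ring

/-- A vector whose block `i` is copied from `e i` has squared norm at most `∑ i, ‖e i‖ ^ 2`. -/
theorem norm_sq_blockwise_le {m n : ℕ} (blk : Fin m → Fin n)
    (e : Fin n → EuclideanSpace ℝ (Fin m)) :
    ‖(WithLp.toLp 2 fun c => e (blk c) c : EuclideanSpace ℝ (Fin m))‖ ^ 2 ≤ ∑ i, ‖e i‖ ^ 2 := by
  simp_rw [EuclideanSpace.real_norm_sq_eq]
  rw [Finset.sum_comm]
  exact Finset.sum_le_sum fun c _ =>
    Finset.single_le_sum (f := fun i => e i c ^ 2) (fun i _ => sq_nonneg _) (Finset.mem_univ _)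

/-- Setting some coordinates to zero does not increase the norm. -/
theorem norm_mask_le {m : ℕ} (p : Fin m → Prop) (g : EuclideanSpace ℝ (Fin m)) :
    ‖(WithLp.toLp 2 fun c => if p c then g c else 0 : EuclideanSpace ℝ (Fin m))‖ ≤ ‖g‖ := by
  refine le_of_sq_le_sq ?_ (norm_nonneg _)
  simp_rw [EuclideanSpace.real_norm_sq_eq]
  refine Finset.sum_le_sum fun c _ => ?_
  split_ifs
  · exact le_rfl
  · simpa using sq_nonneg (g c)

/-- A weighted Young inequality for a square `(G + V) ^ 2` with `V ^ 2` bounded by a multiple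
of `S`. -/
theorem sq_add_le_of_sq_le {n B L γ G V S : ℝ} (hn : 1 ≤ n) (hB : 0 < B) (hL : 0 < L)
    (hγ : 0 < γ) (hS : 0 ≤ S)
    (hV : V ^ 2 ≤ n * (L ^ 2 * (γ ^ 2 * B * S))) :
    (G + V) ^ 2 ≤ (n ^ 2 * B * γ ^ 2 * L ^ 2 + L * n) * S + (1 + γ ^ 2 * L * n * B) * G ^ 2 := by
  have hk : 0 < L * γ ^ 2 * B := by positivity
  have hyoung : 2 * G * V ≤ L * γ ^ 2 * B * G ^ 2 + V ^ 2 / (L * γ ^ 2 * B) := by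
    have hsq : L * γ ^ 2 * B * G ^ 2 + V ^ 2 / (L * γ ^ 2 * B) - 2 * G * V
        = (L * γ ^ 2 * B * G - V) ^ 2 / (L * γ ^ 2 * B) := by
      field_simp
      ring
    have : 0 ≤ (L * γ ^ 2 * B * G - V) ^ 2 / (L * γ ^ 2 * B) := by positivity
    linarith
  have hdiv : V ^ 2 / (L * γ ^ 2 * B) ≤ L * n * S := by
    rw [div_le_iff₀ hk]
    linarith
  have hG : L * γ ^ 2 * B * G ^ 2 ≤ L * γ ^ 2 * B * G ^ 2 * n :=
    le_mul_of_one_le_right (by positivity) hn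
  have hnn : n * (L ^ 2 * (γ ^ 2 * B * S)) ≤ n * (L ^ 2 * (γ ^ 2 * B * S)) * n :=
    le_mul_of_one_le_right (by positivity) hn
  linarith

theorem one_step_square_difference
    (m n B : ℕ) (hn : 0 < n) (hB : 1 ≤ B)
    (f : EuclideanSpace ℝ (Fin m) → ℝ) (μ L γ fstar : ℝ)
    (hμ : 0 < μ) (hL : 0 < L) (hγ : 0 < γ)
    (hdiff : Differentiable ℝ f)
    (hmin : ∀ z, fstar ≤ f z) (hattain : ∃ z, f z = fstar)
    (hPL : ∀ z, μ * (f z - fstar) ≤ (1 / 2) * ‖gradient f z‖ ^ 2)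
    (hLip : ∀ y z, ‖gradient f z - gradient f y‖ ≤ L * ‖z - y‖)
    (hstatfin : {z : EuclideanSpace ℝ (Fin m) | gradient f z = 0}.Finite)
    (hstatne : {z : EuclideanSpace ℝ (Fin m) | gradient f z = 0}.Nonempty)
    (blk : Fin m → Fin n) (T : Fin n → Set ℕ) (τ : Fin n → Fin n → ℕ → ℕ)
    (X : Fin n → ℕ → EuclideanSpace ℝ (Fin m))
    (x s : ℕ → EuclideanSpace ℝ (Fin m))
    (hτle : ∀ i j t, τ i j t ≤ t)
    (hread : ∀ i j, j ≠ i → ∀ t c, blk c = j → X i t c = X j (τ i j t) c)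
    (hupd : ∀ i t c, blk c = i →
      X i (t + 1) c = if t ∈ T i then X i t c - γ * gradient f (X i t) c else X i t c)
    (hx : ∀ t c, x t c = X (blk c) t c)
    (hs : ∀ t c, s t c = if t ∈ T (blk c) then -(gradient f (X (blk c) t) c) else 0)
    (hasync1 : ∀ i t, ∃ t' ∈ Finset.Ico t (t + B), t' ∈ T i)
    (hasync2 : ∀ i j t, t ∈ T i → j ≠ i → t < τ i j t + B)
    :
    ∀ t : ℕ,
      ‖x (t + 1) - x t‖ ^ 2 ≤
        ((n : ℝ) ^ 2 * (B : ℝ) * γ ^ 4 * L ^ 2 + γ ^ 2 * L * (n : ℝ)) *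
          ∑ τ' ∈ Finset.Ico (t - B) t, ‖s τ'‖ ^ 2 +
        (γ ^ 2 + γ ^ 4 * L * (n : ℝ) * (B : ℝ)) * ‖gradient f (x t)‖ ^ 2 := by
  intro t
  have hstep : ∀ r, x (r + 1) - x r = γ • s r := by
    intro r
    ext c
    rw [PiLp.sub_apply, PiLp.smul_apply, smul_eq_mul, hx, hx, hupd _ _ _ rfl, hs]
    split_ifs <;> ring
  set S := ∑ r ∈ Finset.Ico (t - B) t, ‖s r‖ ^ 2
  have hS0 : 0 ≤ S := Finset.sum_nonneg fun _ _ => sq_nonneg _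
  let e : Fin n → EuclideanSpace ℝ (Fin m) := fun i =>
    if t ∈ T i then gradient f (X i t) - gradient f (x t) else 0
  have he : ∀ i, ‖e i‖ ^ 2 ≤ L ^ 2 * (γ ^ 2 * B * S) := by
    intro i
    by_cases hi : t ∈ T i
    · have hstale : ‖X i t - x t‖ ^ 2 ≤ γ ^ 2 * B * S := by
        refine norm_sq_stale_sub_le hstep _ fun c => ?_
        by_cases hc : blk c = i
        · exact ⟨t, le_rfl, Nat.le_add_right t B, by rw [hx, hc]⟩
        · exact ⟨τ i (blk c) t, hτle _ _ _, (hasync2 i _ t hi hc).le, by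
            rw [hx, hread i _ hc t c rfl]⟩
      simp only [e, if_pos hi]
      calc ‖gradient f (X i t) - gradient f (x t)‖ ^ 2 ≤ (L * ‖X i t - x t‖) ^ 2 := by
            gcongr
            exact hLip _ _
        _ = L ^ 2 * ‖X i t - x t‖ ^ 2 := mul_pow _ _ _
        _ ≤ _ := by gcongr
    · simp only [e, if_neg hi, norm_zero]
      rw [zero_pow two_ne_zero]
      positivity
  set v : EuclideanSpace ℝ (Fin m) := WithLp.toLp 2 fun c => e (blk c) c with hv
  have hv2 : ‖v‖ ^ 2 ≤ n * (L ^ 2 * (γ ^ 2 * B * S)) :=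
    (norm_sq_blockwise_le blk e).trans <|
      (Finset.sum_le_sum fun i _ => he i).trans_eq (by simp)
  have hsplit : s t = -((WithLp.toLp 2 fun c =>
      if t ∈ T (blk c) then gradient f (x t) c else 0 : EuclideanSpace ℝ (Fin m)) + v) := by
    ext c
    simp only [hs, hv, e, PiLp.neg_apply, PiLp.add_apply]
    split_ifs <;> simp
  have hst : ‖s t‖ ≤ ‖gradient f (x t)‖ + ‖v‖ := by
    rw [hsplit, norm_neg]
    exact (norm_add_le _ _).trans (by gcongr; exact norm_mask_le _ _)
  have hmain := sq_add_le_of_sq_le (G := ‖gradient f (x t)‖) (by exact_mod_cast hn)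
    (by exact_mod_cast hB) hL hγ hS0 hv2
  calc ‖x (t + 1) - x t‖ ^ 2 = γ ^ 2 * ‖s t‖ ^ 2 := by
        rw [hstep, norm_smul, mul_pow, Real.norm_eq_abs, sq_abs]
    _ ≤ γ ^ 2 * (‖gradient f (x t)‖ + ‖v‖) ^ 2 := by gcongr
    _ ≤ γ ^ 2 * _ := mul_le_mul_of_nonneg_left hmain (sq_nonneg γ)
    _ = _ := by ring
end

section
/- Suppose γ < 1/( L(B/2)(n+1) + 1/γ-scale ) is small enough that C₄ := γ − γ²L((B/2)(n+1) + 1) > 0. Then for all t ≥ 2B, with α(t) = f(x(t)) − f* and β(t) = γ² Σ_{τ=t−B}^{t−1} ‖s(τ)‖², one has γ^{-2} β(t) ≤ (1/C₄)( α(t−B) + (L/2)nB β(t−B) − α(t) ). -/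
open scoped BigOperators
open Classical

/-- The descent lemma: a function with `L`-Lipschitz gradient lies below its quadratic upper model. -/
theorem le_quadratic_of_gradient_lipschitz {E : Type*} [NormedAddCommGroup E]
    [InnerProductSpace ℝ E] [CompleteSpace E] {f : E → ℝ} {L : ℝ} (hdiff : Differentiable ℝ f)
    (hLip : ∀ y z, ‖gradient f z - gradient f y‖ ≤ L * ‖z - y‖) (x d : E) :
    f (x + d) ≤ f x + inner ℝ (gradient f x) d + L / 2 * ‖d‖ ^ 2 := by
  set h : ℝ → ℝ := fun r => f (x + r • d) - r * inner ℝ (gradient f x) d - L / 2 * ‖d‖ ^ 2 * r ^ 2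
  have hderiv (r : ℝ) : HasDerivAt h (inner ℝ (gradient f (x + r • d)) d
      - inner ℝ (gradient f x) d - L * ‖d‖ ^ 2 * r) r := by
    have hline : HasDerivAt (fun r : ℝ => x + r • d) d r := by
      simpa using ((hasDerivAt_id r).smul_const d).const_add x
    have hf : HasDerivAt (fun r : ℝ => f (x + r • d)) (inner ℝ (gradient f (x + r • d)) d) r := by
      exact (hdiff (x + r • d)).hasGradientAt.hasFDerivAt.comp_hasDerivAt r hline
    have h2 := (hf.sub ((hasDerivAt_id r).mul_const (inner ℝ (gradient f x) d))).sub
      ((hasDerivAt_pow 2 r).const_mul (L / 2 * ‖d‖ ^ 2))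
    refine h2.congr_deriv ?_
    norm_num
    ring
  have hanti : AntitoneOn h (Set.Icc 0 1) := by
    refine antitoneOn_of_deriv_nonpos (convex_Icc 0 1)
      (fun r _ => (hderiv r).continuousAt.continuousWithinAt)
      (fun r _ => (hderiv r).differentiableAt.differentiableWithinAt) fun r hr => ?_
    rw [interior_Icc] at hr
    rw [(hderiv r).deriv, ← inner_sub_left]
    have hlip := hLip x (x + r • d)
    rw [add_sub_cancel_left, norm_smul, Real.norm_of_nonneg hr.1.le] at hlip
    have := real_inner_le_norm (gradient f (x + r • d) - gradient f x) d
    nlinarith [norm_nonneg d]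
  have := hanti (Set.left_mem_Icc.2 zero_le_one) (Set.right_mem_Icc.2 zero_le_one) zero_le_one
  simp only [h, one_smul, zero_smul, add_zero] at this
  linarith

/-- Along `x (t + 1) = x t + γ • s t`, a state that reads every coordinate with a delay of at
most `B` differs from the current one by at most the accumulated recent steps. -/
theorem norm_delayed_sub_sq_le {ι : Type*} [Fintype ι] {γ : ℝ} {B t : ℕ}
    {x s : ℕ → EuclideanSpace ℝ ι} {y : EuclideanSpace ℝ ι}
    (hstep : ∀ t c, x (t + 1) c = x t c + γ * s t c)
    (hy : ∀ c, ∃ k, t - B ≤ k ∧ k ≤ t ∧ y c = x k c) :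
    ‖x t - y‖ ^ 2 ≤ γ ^ 2 * B * ∑ k ∈ Finset.Ico (t - B) t, ‖s k‖ ^ 2 := by
  simp_rw [EuclideanSpace.real_norm_sq_eq]
  rw [Finset.sum_comm, Finset.mul_sum]
  refine Finset.sum_le_sum fun c _ => ?_
  obtain ⟨k, hk1, hk2, hyc⟩ := hy c
  have htel : x t c - y c = γ * ∑ l ∈ Finset.Ico k t, s l c := by
    rw [hyc, ← Finset.sum_Ico_sub (fun l => x l c) hk2, Finset.mul_sum]
    exact Finset.sum_congr rfl fun l _ => by rw [hstep]; ring
  have hsub : Finset.Ico k t ⊆ Finset.Ico (t - B) t := Finset.Ico_subset_Ico_left hk1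
  have hcard : ((Finset.Ico k t).card : ℝ) ≤ B := by
    rw [Nat.card_Ico]
    exact_mod_cast (by omega : t - k ≤ B)
  rw [PiLp.sub_apply, htel, mul_pow, mul_assoc]
  gcongr
  calc (∑ l ∈ Finset.Ico k t, s l c) ^ 2
      ≤ (Finset.Ico k t).card * ∑ l ∈ Finset.Ico k t, s l c ^ 2 := sq_sum_le_card_mul_sum_sq
    _ ≤ B * ∑ l ∈ Finset.Ico (t - B) t, s l c ^ 2 := by
      gcongr

/-- Young's inequality over blocks: if the direction `s` agrees, block by block, either with zero or
with minus a vector `g i` close to `G`, then `⟪G, s⟫` is close to `-‖s‖ ^ 2`. -/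
theorem inner_le_of_blockwise_approx {ι κ : Type*} [Fintype ι] [Fintype κ] [DecidableEq κ]
    {a ε : ℝ} (ha : 0 < a) (hε : 0 ≤ ε) (blk : ι → κ) (U : κ → Prop) (G s : EuclideanSpace ℝ ι)
    (g : κ → EuclideanSpace ℝ ι) (hs : ∀ c, U (blk c) → s c = -g (blk c) c)
    (hs0 : ∀ c, ¬ U (blk c) → s c = 0) (hg : ∀ i, U i → ‖G - g i‖ ^ 2 ≤ ε) :
    inner ℝ G s ≤ -‖s‖ ^ 2 + a / 2 * ‖s‖ ^ 2 + Fintype.card κ * (ε / (2 * a)) := by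
  have hblock (i : κ) : ∑ c with blk c = i, (G c + s c) * s c
      ≤ a / 2 * ∑ c with blk c = i, s c ^ 2 + ε / (2 * a) := by
    by_cases hi : U i
    · have hsum : ∑ c with blk c = i, (G c - g i c) ^ 2 ≤ ε := by
        refine le_trans ?_ (hg i hi)
        rw [EuclideanSpace.real_norm_sq_eq]
        exact Finset.sum_le_univ_sum_of_nonneg fun c => sq_nonneg _
      calc ∑ c with blk c = i, (G c + s c) * s c
          ≤ ∑ c with blk c = i, (a / 2 * s c ^ 2 + (G c - g i c) ^ 2 / (2 * a)) := by
            refine Finset.sum_le_sum fun c hc => ?_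
            obtain rfl : blk c = i := (Finset.mem_filter.1 hc).2
            have hgc : g (blk c) c = -s c := by rw [hs c hi, neg_neg]
            rw [hgc, sub_neg_eq_add, ← sub_nonneg]
            have : a / 2 * s c ^ 2 + (G c + s c) ^ 2 / (2 * a) - (G c + s c) * s c
                = (a * s c - (G c + s c)) ^ 2 / (2 * a) := by
              field_simp
              ring
            rw [this]
            positivity
        _ ≤ _ := by
            rw [Finset.sum_add_distrib, ← Finset.mul_sum, ← Finset.sum_div]
            gcongr
    · have h0 : ∀ c ∈ Finset.univ.filter (blk · = i), s c = 0 := fun c hc =>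
        hs0 c (by rwa [(Finset.mem_filter.1 hc).2])
      rw [Finset.sum_eq_zero fun c hc => by rw [h0 c hc, mul_zero]]
      positivity
  have htotal := Finset.sum_le_sum fun i (_ : i ∈ Finset.univ) => hblock i
  rw [Finset.sum_add_distrib, ← Finset.mul_sum, Finset.sum_fiberwise, Finset.sum_fiberwise,
    Finset.sum_const, nsmul_eq_mul, Finset.card_univ, ← EuclideanSpace.real_norm_sq_eq] at htotal
  have hsplit : ∑ c, (G c + s c) * s c = inner ℝ G s + ‖s‖ ^ 2 := by
    rw [EuclideanSpace.real_norm_sq_eq, PiLp.inner_apply, ← Finset.sum_add_distrib]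
    refine Finset.sum_congr rfl fun c _ => ?_
    simp only [RCLike.inner_apply, conj_trivial]
    ring
  linarith

/-- Summing windows of length `B` over a window of length `B`. -/
theorem sum_windows_le {q : ℕ → ℝ} (hq : ∀ t, 0 ≤ q t) (B t : ℕ) (ht : 2 * B ≤ t) :
    ∑ u ∈ Finset.Ico (t - B) t, ∑ k ∈ Finset.Ico (u - B) u, q k
      ≤ B * (∑ k ∈ Finset.Ico (t - B - B) (t - B), q k + ∑ k ∈ Finset.Ico (t - B) t, q k) := by
  rw [Finset.sum_Ico_consecutive _ (by omega) (by omega)]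
  calc _ ≤ ∑ _u ∈ Finset.Ico (t - B) t, ∑ k ∈ Finset.Ico (t - B - B) t, q k := by
        refine Finset.sum_le_sum fun u hu => ?_
        rw [Finset.mem_Ico] at hu
        exact Finset.sum_le_sum_of_subset_of_nonneg
          (Finset.Ico_subset_Ico (by omega) (by omega)) fun k _ _ => hq k
    _ = _ := by
        rw [Finset.sum_const, Nat.card_Ico, nsmul_eq_mul, Nat.sub_sub_self (by omega)]

theorem beta_bound
    (m n B : ℕ) (hn : 0 < n) (hB : 1 ≤ B)
    (f : EuclideanSpace ℝ (Fin m) → ℝ) (μ L γ fstar : ℝ)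
    (hμ : 0 < μ) (hL : 0 < L) (hγ : 0 < γ)
    (hdiff : Differentiable ℝ f)
    (hmin : ∀ z, fstar ≤ f z) (hattain : ∃ z, f z = fstar)
    (hPL : ∀ z, μ * (f z - fstar) ≤ (1 / 2) * ‖gradient f z‖ ^ 2)
    (hLip : ∀ y z, ‖gradient f z - gradient f y‖ ≤ L * ‖z - y‖)
    (hstatfin : {z : EuclideanSpace ℝ (Fin m) | gradient f z = 0}.Finite)
    (hstatne : {z : EuclideanSpace ℝ (Fin m) | gradient f z = 0}.Nonempty)
    (blk : Fin m → Fin n) (T : Fin n → Set ℕ) (τ : Fin n → Fin n → ℕ → ℕ)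
    (X : Fin n → ℕ → EuclideanSpace ℝ (Fin m))
    (x s : ℕ → EuclideanSpace ℝ (Fin m))
    (hτle : ∀ i j t, τ i j t ≤ t)
    (hread : ∀ i j, j ≠ i → ∀ t c, blk c = j → X i t c = X j (τ i j t) c)
    (hupd : ∀ i t c, blk c = i →
      X i (t + 1) c = if t ∈ T i then X i t c - γ * gradient f (X i t) c else X i t c)
    (hx : ∀ t c, x t c = X (blk c) t c)
    (hs : ∀ t c, s t c = if t ∈ T (blk c) then -(gradient f (X (blk c) t) c) else 0)
    (hasync1 : ∀ i t, ∃ t' ∈ Finset.Ico t (t + B), t' ∈ T i)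
    (hasync2 : ∀ i j t, t ∈ T i → j ≠ i → t < τ i j t + B)
    (alpha beta : ℕ → ℝ)
    (halpha : ∀ t, alpha t = f (x t) - fstar)
    (hbeta : ∀ t, beta t = γ ^ 2 * ∑ τ' ∈ Finset.Ico (t - B) t, ‖s τ'‖ ^ 2)
    (C4 : ℝ)
    (hC4 : C4 = γ - γ ^ 2 * L * (((B : ℝ) / 2) * ((n : ℝ) + 1) + 1)) (hC4pos : 0 < C4) :
    ∀ t : ℕ, 2 * B ≤ t →
      (γ ^ 2)⁻¹ * beta t ≤
        (1 / C4) * (alpha (t - B) + (L / 2) * (n : ℝ) * (B : ℝ) * beta (t - B) - alpha t) := by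
  intro t ht
  have hB0 : (0 : ℝ) < B := by exact_mod_cast hB
  have hstep (t : ℕ) (c : Fin m) : x (t + 1) c = x t c + γ * s t c := by
    rw [hx, hx, hs, hupd _ t c rfl]
    split_ifs <;> ring
  have hdescent (u : ℕ) : f (x (u + 1)) - f (x u) ≤
      (-γ + γ ^ 2 * L * (B + 1) / 2) * ‖s u‖ ^ 2
        + γ ^ 2 * L * n / 2 * ∑ k ∈ Finset.Ico (u - B) u, ‖s k‖ ^ 2 := by
    set Q := ∑ k ∈ Finset.Ico (u - B) u, ‖s k‖ ^ 2
    have hgrad (i : Fin n) (hi : u ∈ T i) :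
        ‖gradient f (x u) - gradient f (X i u)‖ ^ 2 ≤ L ^ 2 * (γ ^ 2 * B * Q) := by
      have hdelay : ‖x u - X i u‖ ^ 2 ≤ γ ^ 2 * B * Q := by
        refine norm_delayed_sub_sq_le hstep fun c => ?_
        by_cases hc : blk c = i
        · exact ⟨u, by omega, le_rfl, by rw [hx, hc]⟩
        · have := hasync2 i (blk c) u hi hc
          exact ⟨τ i (blk c) u, by omega, hτle _ _ _, by rw [hx, hread i (blk c) hc u c rfl]⟩
      calc _ ≤ (L * ‖x u - X i u‖) ^ 2 := by gcongr; exact hLip _ _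
        _ ≤ _ := by rw [mul_pow]; gcongr
    have hinner := inner_le_of_blockwise_approx (a := L * γ * B) (by positivity) (by positivity)
      blk (fun i => u ∈ T i) (gradient f (x u)) (s u) (fun i => gradient f (X i u))
      (fun c hc => by rw [hs, if_pos hc]) (fun c hc => by rw [hs, if_neg hc]) hgrad
    have hquad := le_quadratic_of_gradient_lipschitz hdiff hLip (x u) (γ • s u)
    have hxs : x u + γ • s u = x (u + 1) := by
      ext c
      simp [hstep]
    rw [hxs, inner_smul_right, norm_smul, mul_pow, Real.norm_of_nonneg hγ.le] at hquad
    rw [Fintype.card_fin] at hinner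
    have hcoef : L ^ 2 * (γ ^ 2 * B * Q) / (2 * (L * γ * B)) = L * γ * Q / 2 := by
      field_simp
    rw [hcoef] at hinner
    have := mul_le_mul_of_nonneg_left hinner hγ.le
    linarith
  have hsum := Finset.sum_le_sum fun u (_ : u ∈ Finset.Ico (t - B) t) => hdescent u
  rw [Finset.sum_Ico_sub (fun u => f (x u)) (by omega), Finset.sum_add_distrib, ← Finset.mul_sum,
    ← Finset.mul_sum] at hsum
  have hwin := sum_windows_le (fun k => sq_nonneg ‖s k‖) B t ht
  rw [hbeta, hbeta, halpha, halpha, inv_mul_cancel_left₀ (by positivity), one_div,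
    le_inv_mul_iff₀ hC4pos, hC4]
  have hS : 0 ≤ ∑ k ∈ Finset.Ico (t - B) t, ‖s k‖ ^ 2 := by positivity
  have hwin' := mul_le_mul_of_nonneg_left hwin (by positivity : 0 ≤ γ ^ 2 * L * n / 2)
  have hslack : 0 ≤ γ ^ 2 * L / 2 * ∑ k ∈ Finset.Ico (t - B) t, ‖s k‖ ^ 2 := by positivity
  linarith
end
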